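/- arXiv:2504.09336 — 2 statements merged into one kernel-verified Lean document; each statement's English description precedes it below -/
import Mathlib

section
/- Let x_{k−3/2} < x_{k−1/2} < x_{k+1/2} < x_{k+3/2} be real numbers with cell midpoints x_{k−1}, x_k, x_{k+1} (each the average of the two neighboring edges), and let u_{k−1}, u_k, u_{k+1} be real numbers. Define the candidate slopes s₋ = (u_k − u_{k−1})/(x_k − x_{k−1}) and s₊ = (u_{k+1} − u_k)/(x_{k+1} − x_k), the limited slope s_k = minmod(s₋, s₊), and p_k(x) = u_k + s_k (x − x_k). Then p_k(x_{k+1/2}) lies in the closed interval with endpoints u_k and u_{k+1}, and p_k(x_{k−1/2}) lies in the closed interval with endpoints u_{k−1} and u_k. -/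
/-- The minmod limiter function: `0` if `a` and `b` have opposite signs,
otherwise the one of `a`, `b` with the smaller absolute value
(taking `a` in case of a tie). -/
noncomputable def minmod (a b : ℝ) : ℝ :=
  if a * b < 0 then 0 else if |a| ≤ |b| then a else b

/-- A number of the same sign as `b` and of at most the same absolute value lies
between zero and `b`. -/
theorem mem_uIcc_zero_of_abs_le {a b : ℝ} (hab : 0 ≤ a * b) (h : |a| ≤ |b|) :
    a ∈ Set.uIcc 0 b := by
  rw [Set.mem_uIcc]
  rcases mul_nonneg_iff.1 hab with ⟨ha, hb⟩ | ⟨ha, hb⟩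
  · rw [abs_of_nonneg ha, abs_of_nonneg hb] at h
    exact Or.inl ⟨ha, h⟩
  · rw [abs_of_nonpos ha, abs_of_nonpos hb] at h
    exact Or.inr ⟨neg_le_neg_iff.1 h, ha⟩

/-- The minmod of two slopes lies between zero and the first slope. -/
theorem minmod_mem_uIcc_left (a b : ℝ) : minmod a b ∈ Set.uIcc 0 a := by
  unfold minmod
  split_ifs with hab h
  · exact Set.left_mem_uIcc
  · exact Set.right_mem_uIcc
  · exact mem_uIcc_zero_of_abs_le (mul_comm a b ▸ not_lt.1 hab) (not_le.1 h).le

/-- The minmod of two slopes lies between zero and the second slope. -/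
theorem minmod_mem_uIcc_right (a b : ℝ) : minmod a b ∈ Set.uIcc 0 b := by
  unfold minmod
  split_ifs with hab h
  · exact Set.left_mem_uIcc
  · exact mem_uIcc_zero_of_abs_le (not_lt.1 hab) h
  · exact Set.right_mem_uIcc

/-- Shrinking both the slope and the increment towards zero keeps an affine
function between its base value and its original end value. -/
theorem add_mul_mem_uIcc {s a d D : ℝ} (u : ℝ) (hs : s ∈ Set.uIcc 0 a)
    (hd : d ∈ Set.uIcc 0 D) : u + s * d ∈ Set.uIcc u (u + a * D) := by
  rw [Set.mem_uIcc] at *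
  rcases hs with ⟨hs₀, hsa⟩ | ⟨hsa, hs₀⟩ <;> rcases hd with ⟨hd₀, hdD⟩ | ⟨hdD, hd₀⟩
  · left; constructor <;> nlinarith
  · right; constructor <;> nlinarith
  · right; constructor <;> nlinarith
  · left; constructor <;> nlinarith

/-- **No new extrema for the minmod-limited MUSCL reconstruction.**
Given edges `x₀ < x₁ < x₂ < x₃` with midpoints `m₀, m₁, m₂` and cell averages
`u₀, u₁, u₂`, the limited affine reconstruction
`p x = u₁ + minmod(sm, sp)·(x − m₁)` with `sm = (u₁ − u₀)/(m₁ − m₀)` and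
`sp = (u₂ − u₁)/(m₂ − m₁)` satisfies: `p x₂` lies in the closed interval with
endpoints `u₁` and `u₂`, and `p x₁` lies in the closed interval with
endpoints `u₀` and `u₁`. -/
theorem muscl_minmod_edge_values_no_new_extrema
    (x₀ x₁ x₂ x₃ : ℝ) (h₀₁ : x₀ < x₁) (h₁₂ : x₁ < x₂) (h₂₃ : x₂ < x₃)
    (m₀ m₁ m₂ : ℝ)
    (hm₀ : m₀ = (x₀ + x₁) / 2) (hm₁ : m₁ = (x₁ + x₂) / 2) (hm₂ : m₂ = (x₂ + x₃) / 2)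
    (u₀ u₁ u₂ : ℝ)
    (sm sp sk : ℝ)
    (hsm : sm = (u₁ - u₀) / (m₁ - m₀)) (hsp : sp = (u₂ - u₁) / (m₂ - m₁))
    (hsk : sk = minmod sm sp)
    (p : ℝ → ℝ) (hp : ∀ x, p x = u₁ + sk * (x - m₁)) :
    p x₂ ∈ Set.uIcc u₁ u₂ ∧ p x₁ ∈ Set.uIcc u₀ u₁ := by
  have hm : m₁ - m₀ ≠ 0 := ne_of_gt (by linarith)
  have hm' : m₂ - m₁ ≠ 0 := ne_of_gt (by linarith)
  have hu₀ : u₀ = u₁ + sm * (m₀ - m₁) := by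
    rw [hsm]
    field_simp
    ring
  have hu₂ : u₂ = u₁ + sp * (m₂ - m₁) := by
    rw [hsp]
    field_simp
    ring
  rw [hp, hp, hsk]
  constructor
  · rw [hu₂]
    refine add_mul_mem_uIcc u₁ (minmod_mem_uIcc_right sm sp) (Set.mem_uIcc.2 (Or.inl ?_))
    constructor <;> linarith
  · rw [Set.uIcc_comm, hu₀]
    refine add_mul_mem_uIcc u₁ (minmod_mem_uIcc_left sm sp) (Set.mem_uIcc.2 (Or.inr ?_))
    constructor <;> linarith
end

section
/- Let q be a natural number and let a₀ < a₁ < … < a_{q+1} be real numbers, defining the q+1 cells [a_{j−1}, a_j] for j = 1, …, q+1. If p is a real polynomial of degree at most q and ∫_{a_{j−1}}^{a_j} p(x) dx = 0 for every j = 1, …, q+1, then p = 0. Equivalently, the linear map sending a polynomial of degree at most q to its vector of cell averages ( (1/(a_j − a_{j−1})) ∫_{a_{j−1}}^{a_j} p(x) dx )_{j=1,…,q+1} ∈ ℝ^{q+1} is injective, and hence bijective by dimension count. -/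
open intervalIntegral

/-- Over a field of characteristic zero, every polynomial has an antiderivative whose degree
exceeds its own by at most one. -/
theorem Polynomial.exists_derivative_eq_natDegree_le {K : Type*} [Field K] [CharZero K]
    (p : Polynomial K) :
    ∃ P : Polynomial K, derivative P = p ∧ P.natDegree ≤ p.natDegree + 1 := by
  refine ⟨∑ n ∈ Finset.range (p.natDegree + 1), monomial (n + 1) (p.coeff n / (n + 1)), ?_, ?_⟩
  · conv_rhs => rw [p.as_sum_range]
    rw [derivative_sum]
    refine Finset.sum_congr rfl fun n _ => ?_
    have hn : (n + 1 : K) ≠ 0 := Nat.cast_add_one_ne_zero n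
    simp [hn]
  · refine natDegree_sum_le_of_forall_le _ _ fun n hn => (natDegree_monomial_le _).trans ?_
    have := Finset.mem_range.mp hn
    lia

/-- **Invertibility of the averaging operator on polynomials.**
Let `a 0 < a 1 < … < a (q+1)` be the edges of `q+1` cells.  If a real
polynomial `p` of degree at most `q` has vanishing integral
`∫_{a j}^{a (j+1)} p = 0` on every cell, then `p = 0`; i.e. the linear map
sending a polynomial of degree at most `q` to its vector of cell averages
is injective. -/
theorem polynomial_cell_averages_injective
    (q : ℕ) (a : Fin (q + 2) → ℝ) (ha : StrictMono a)
    (p : Polynomial ℝ) (hdeg : p.natDegree ≤ q)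
    (havg : ∀ j : Fin (q + 1),
      ∫ x in (a j.castSucc)..(a j.succ), p.eval x = 0) :
    p = 0 := by
  obtain ⟨P, rfl, hP⟩ := p.exists_derivative_eq_natDegree_le
  have hstep (j : Fin (q + 1)) : P.eval (a j.succ) = P.eval (a j.castSucc) := by
    rw [← sub_eq_zero, ← havg j]
    exact (integral_eq_sub_of_hasDerivAt (fun x _ => P.hasDerivAt x)
      (P.derivative.continuous.intervalIntegrable _ _)).symm
  have hconst (i : Fin (q + 2)) : P.eval (a i) = P.eval (a 0) := by
    induction i using Fin.induction with
    | zero => rfl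
    | succ j ih => rw [hstep, ih]
  have hzero : P - Polynomial.C (P.eval (a 0)) = 0 := by
    refine Polynomial.eq_zero_of_natDegree_lt_card_of_eval_eq_zero _ ha.injective
      (fun i => by simp [hconst i]) ?_
    rw [Polynomial.natDegree_sub_C, Fintype.card_fin]
    lia
  rw [sub_eq_zero.mp hzero, Polynomial.derivative_C]
end
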